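/- Let p be an odd prime and Fp = ZMod p. Let T ⊆ GL_5(Fp) be the set of matrices [[1,0,0,0,r₁],[0,1,0,0,r₂],[0,0,1,0,r₃],[r₁,r₂,r₃,1,r₄],[0,0,0,0,1]] for r₁, r₂, r₃, r₄ ∈ Fp. Then the number of distinct sets of the form { Q_P·M·Q_P⁻¹ : M ∈ T }, as P ranges over GL_4(Fp) and Q_P = [[P,0],[0,1]] ∈ GL_5(Fp), equals p²·(p⁴ − 1)(p³ − 1). -/

import Mathlib

open Matrix

/-- The block matrix `Q = [[P, 0], [0, 1]]`. -/
def QofP (p n : ℕ) (P : Matrix (Fin n) (Fin n) (ZMod p)) :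
    Matrix (Fin (n + 1)) (Fin (n + 1)) (ZMod p) :=
  Matrix.reindex finSumFinEquiv finSumFinEquiv
    (Matrix.fromBlocks P 0 0 (1 : Matrix (Fin 1) (Fin 1) (ZMod p)))

section Counting

variable {p : ℕ} [Fact p.Prime]

theorem card_sq_eq (hp : p ≠ 2) (a : ZMod p) :
    (Nat.card {x : ZMod p // x ^ 2 = a} : ℤ) = quadraticChar (ZMod p) a + 1 := by
  rw [← quadraticChar_card_sqrts (by rwa [ZMod.ringChar_zmod_n]) a, Nat.card_eq_fintype_card,
    Set.toFinset_card]
  rfl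

theorem card_circle_zero (hp : p ≠ 2) :
    (Nat.card {x : ZMod p × ZMod p // x.1 ^ 2 + x.2 ^ 2 = 0} : ℤ) =
      p + (p - 1) * quadraticChar (ZMod p) (-1) := by
  have e : {x : ZMod p × ZMod p // x.1 ^ 2 + x.2 ^ 2 = 0} ≃
      (Σ y : ZMod p, {x : ZMod p // x ^ 2 = -y ^ 2}) :=
    { toFun := fun x => ⟨x.1.2, x.1.1, eq_neg_of_add_eq_zero_left x.2⟩
      invFun := fun z => ⟨(z.2.1, z.1), by simp [z.2.2]⟩
      left_inv := fun _ => rfl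
      right_inv := fun _ => rfl }
  have h (y : ZMod p) : quadraticChar (ZMod p) (-y ^ 2) =
      quadraticChar (ZMod p) (-1) * if y = 0 then 0 else 1 := by
    rw [neg_eq_neg_one_mul, map_mul]
    split_ifs with hy
    · simp [hy]
    · rw [quadraticChar_sq_one' hy]
  rw [Nat.card_congr e, Nat.card_sigma]
  push_cast
  simp_rw [card_sq_eq hp, h]
  rw [Finset.sum_add_distrib, ← Finset.mul_sum, Finset.sum_ite]
  simp [Finset.filter_ne', Finset.card_erase_of_mem, ZMod.card,
    Nat.cast_sub (Fact.out : p.Prime).one_le]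
  ring

/-- Multiplying by `a + b i` with `a ^ 2 + b ^ 2 = c` identifies the circles of radii `1` and `c`. -/
theorem card_circle_eq {c : ZMod p} (hc : c ≠ 0) :
    Nat.card {x : ZMod p × ZMod p // x.1 ^ 2 + x.2 ^ 2 = c} =
      Nat.card {x : ZMod p × ZMod p // x.1 ^ 2 + x.2 ^ 2 = 1} := by
  obtain ⟨a, b, hab⟩ := ZMod.sq_add_sq p c
  refine Nat.card_congr
    { toFun := fun x => ⟨((a * x.1.1 + b * x.1.2) / c, (a * x.1.2 - b * x.1.1) / c), ?_⟩
      invFun := fun x => ⟨(a * x.1.1 - b * x.1.2, a * x.1.2 + b * x.1.1), ?_⟩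
      left_inv := ?_
      right_inv := ?_ }
  · have := x.2
    field_simp
    linear_combination (a ^ 2 + b ^ 2) * this + c * hab
  · linear_combination (a ^ 2 + b ^ 2) * x.2 + hab
  · rintro ⟨⟨x, y⟩, h⟩
    ext <;> simp <;> field_simp
    · linear_combination x * hab
    · linear_combination y * hab
  · rintro ⟨⟨x, y⟩, h⟩
    ext <;> simp <;> field_simp
    · linear_combination x * hab
    · linear_combination y * hab

theorem card_circle_one (hp : p ≠ 2) :
    (Nat.card {x : ZMod p × ZMod p // x.1 ^ 2 + x.2 ^ 2 = 1} : ℤ) =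
      p - quadraticChar (ZMod p) (-1) := by
  have h := Nat.card_congr (Equiv.sigmaFiberEquiv fun x : ZMod p × ZMod p => x.1 ^ 2 + x.2 ^ 2)
  rw [Nat.card_sigma, ← Finset.add_sum_erase _ _ (Finset.mem_univ (0 : ZMod p)),
    Finset.sum_congr rfl fun c hc => card_circle_eq (Finset.ne_of_mem_erase hc)] at h
  simp only [Finset.sum_const, Finset.card_erase_of_mem (Finset.mem_univ _), Finset.card_univ,
    ZMod.card, Nat.card_prod, Nat.card_zmod, smul_eq_mul] at h
  have h' := congrArg (Nat.cast : ℕ → ℤ) h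
  push_cast [Nat.cast_sub (Fact.out : p.Prime).one_le, card_circle_zero hp] at h'
  have hp1 : (p : ℤ) - 1 ≠ 0 := by have := (Fact.out : p.Prime).two_le; omega
  apply mul_left_cancel₀ hp1
  linear_combination h'

theorem card_sphere (hp : p ≠ 2) :
    (Nat.card {v : Fin 3 → ZMod p // v ⬝ᵥ v = 1} : ℤ) =
      p * (p + quadraticChar (ZMod p) (-1)) := by
  have e : {v : Fin 3 → ZMod p // v ⬝ᵥ v = 1} ≃
      (Σ z : ZMod p, {x : ZMod p × ZMod p // x.1 ^ 2 + x.2 ^ 2 = 1 - z ^ 2}) :=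
    { toFun := fun v => ⟨v.1 0, (v.1 1, v.1 2), by
        have := v.2
        rw [vec3_dotProduct] at this
        linear_combination this⟩
      invFun := fun z => ⟨![z.1, z.2.1.1, z.2.1.2], by
        have := z.2.2
        rw [vec3_dotProduct]
        simp
        linear_combination this⟩
      left_inv := fun v => by ext i; fin_cases i <;> rfl
      right_inv := fun _ => rfl }
  have h (z : ZMod p) :
      (Nat.card {x : ZMod p × ZMod p // x.1 ^ 2 + x.2 ^ 2 = 1 - z ^ 2} : ℤ) =
        (p - quadraticChar (ZMod p) (-1)) +
          (p * quadraticChar (ZMod p) (-1)) * if z ^ 2 = 1 then 1 else 0 := by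
    split_ifs with hz
    · rw [hz, sub_self, card_circle_zero hp]
      ring
    · rw [card_circle_eq (sub_ne_zero.mpr (Ne.symm hz)), card_circle_one hp]
      ring
  have h1 := card_sq_eq hp (1 : ZMod p)
  rw [Nat.card_eq_fintype_card, Fintype.card_subtype, map_one] at h1
  rw [Nat.card_congr e, Nat.card_sigma]
  push_cast
  simp_rw [h]
  rw [Finset.sum_add_distrib, ← Finset.mul_sum, Finset.sum_boole, h1]
  simp [ZMod.card]
  ring

end Counting

/-- Over a field of characteristic not two, unit vectors are exchanged by an orthogonal involution,
namely plus or minus a reflection. -/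
theorem exists_dotProduct_involution {K : Type*} [Field K] (h2 : (2 : K) ≠ 0) {n : ℕ}
    {v w : Fin n → K} (hv : v ⬝ᵥ v = 1) (hw : w ⬝ᵥ w = 1) :
    ∃ f : (Fin n → K) → (Fin n → K), Function.Involutive f ∧
      (∀ x y, f x ⬝ᵥ f y = x ⬝ᵥ y) ∧ f v = w := by
  have key (m : Fin n → K) (hm : m ⬝ᵥ m ≠ 0) (ε : K) (hε : ε ^ 2 = 1) :
      Function.Involutive (fun x => ε • (x - (2 * (x ⬝ᵥ m) / (m ⬝ᵥ m)) • m)) ∧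
      ∀ x y, (ε • (x - (2 * (x ⬝ᵥ m) / (m ⬝ᵥ m)) • m)) ⬝ᵥ
        (ε • (y - (2 * (y ⬝ᵥ m) / (m ⬝ᵥ m)) • m)) = x ⬝ᵥ y := by
    refine ⟨fun x => ?_, fun x y => ?_⟩
    · ext i
      simp [sub_dotProduct, smul_dotProduct]
      field_simp
      linear_combination (x i * m ⬝ᵥ m) * hε
    · simp [sub_dotProduct, smul_dotProduct, dotProduct_sub, dotProduct_smul, dotProduct_comm m y]
      field_simp
      linear_combination (x ⬝ᵥ y * m ⬝ᵥ m) * hε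
  have hsum : (v - w) ⬝ᵥ (v - w) + (v + w) ⬝ᵥ (v + w) = 2 ^ 2 := by
    simp [sub_dotProduct, dotProduct_sub, hv, hw]
    ring
  have hc := dotProduct_comm w v
  by_cases h : (v - w) ⬝ᵥ (v - w) = 0
  · rw [h, zero_add] at hsum
    have hm : (v + w) ⬝ᵥ (v + w) ≠ 0 := hsum ▸ pow_ne_zero 2 h2
    obtain ⟨h₁, h₂⟩ := key _ hm (-1) (by ring)
    refine ⟨_, h₁, h₂, ?_⟩
    have : 2 * (v ⬝ᵥ (v + w)) / ((v + w) ⬝ᵥ (v + w)) = 1 := by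
      rw [div_eq_one_iff_eq hm]
      simp [hv, hw, hc]
      ring
    simp only [this, one_smul, neg_smul, sub_add_cancel_left, neg_neg]
  · obtain ⟨h₁, h₂⟩ := key _ h 1 (by ring)
    refine ⟨_, h₁, h₂, ?_⟩
    have : 2 * (v ⬝ᵥ (v - w)) / ((v - w) ⬝ᵥ (v - w)) = 1 := by
      rw [div_eq_one_iff_eq h]
      simp [hv, hw, hc, sub_dotProduct]
      ring
    simp only [this, one_smul, sub_sub_cancel]

/-- Pairs of orthogonal unit vectors in dimension three. -/
abbrev OrthonormalPair (K : Type*) [Field K] : Type _ :=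
  {x : (Fin 3 → K) × (Fin 3 → K) // x.1 ⬝ᵥ x.1 = 1 ∧ x.2 ⬝ᵥ x.2 = 1 ∧ x.1 ⬝ᵥ x.2 = 0}

theorem card_orthogonal_unit {p : ℕ} [Fact p.Prime] (hp : p ≠ 2) {v : Fin 3 → ZMod p}
    (hv : v ⬝ᵥ v = 1) :
    (Nat.card {w : Fin 3 → ZMod p // w ⬝ᵥ w = 1 ∧ v ⬝ᵥ w = 0} : ℤ) =
      p - quadraticChar (ZMod p) (-1) := by
  have h2 : (2 : ZMod p) ≠ 0 := Ring.two_ne_zero (by rwa [ZMod.ringChar_zmod_n])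
  obtain ⟨f, hf, hdot, hfv⟩ := exists_dotProduct_involution h2 hv
    (w := ![1, 0, 0]) (by simp)
  have e : {w : Fin 3 → ZMod p // w ⬝ᵥ w = 1 ∧ ![1, 0, 0] ⬝ᵥ w = 0} ≃
      {x : ZMod p × ZMod p // x.1 ^ 2 + x.2 ^ 2 = 1} :=
    { toFun := fun w => ⟨(w.1 1, w.1 2), by
        obtain ⟨h, h'⟩ := w.2
        simp only [vec3_dotProduct] at h h'
        simp at h'
        rw [h'] at h
        linear_combination h⟩
      invFun := fun x => ⟨![0, x.1.1, x.1.2], by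
        have := x.2
        simp
        linear_combination this⟩
      left_inv := fun w => by
        have h' := w.2.2
        simp only [vec3_dotProduct] at h'
        simp at h'
        ext i
        fin_cases i
        · exact h'.symm
        · rfl
        · rfl
      right_inv := fun _ => rfl }
  rw [← card_circle_one hp, ← Nat.card_congr e]
  exact congrArg _ (Nat.card_congr (hf.toPerm.subtypeEquiv fun w => by
    rw [← hfv]
    simp only [Function.Involutive.coe_toPerm, hdot]))

theorem card_orthonormalPair {p : ℕ} [Fact p.Prime] (hp : p ≠ 2) :
    Nat.card (OrthonormalPair (ZMod p)) = p * (p ^ 2 - 1) := by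
  have e : OrthonormalPair (ZMod p) ≃ (Σ v : {v : Fin 3 → ZMod p // v ⬝ᵥ v = 1},
      {w : Fin 3 → ZMod p // w ⬝ᵥ w = 1 ∧ v.1 ⬝ᵥ w = 0}) :=
    { toFun := fun x => ⟨⟨x.1.1, x.2.1⟩, x.1.2, x.2.2⟩
      invFun := fun z => ⟨(z.1.1, z.2.1), z.1.2, z.2.2⟩
      left_inv := fun _ => rfl
      right_inv := fun _ => rfl }
  have h1 : 1 ≤ p ^ 2 := Nat.one_le_pow _ _ (Fact.out : p.Prime).pos
  have hχ := quadraticChar_sq_one (F := ZMod p) (neg_ne_zero.mpr one_ne_zero)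
  rw [Nat.card_congr e, Nat.card_sigma]
  zify [h1]
  rw [Finset.sum_congr rfl fun v _ => card_orthogonal_unit hp v.2, Finset.sum_const,
    Finset.card_univ, ← Nat.card_eq_fintype_card, nsmul_eq_mul, card_sphere hp]
  linear_combination -(p : ℤ) * hχ

section Parametrization

variable {K : Type*} [Field K]

/-- The conditions on `P` for `Q_P` to normalize the set of shears: the last basis vector is an
eigenvector and the upper left block is a similitude with the same factor. -/
def IsNormalizing (P : Matrix (Fin 4) (Fin 4) K) : Prop :=
  (∀ k : Fin 3, P k.castSucc (Fin.last 3) = 0) ∧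
    (P.submatrix Fin.castSucc Fin.castSucc)ᵀ * P.submatrix Fin.castSucc Fin.castSucc =
      P (Fin.last 3) (Fin.last 3) • (1 : Matrix (Fin 3) (Fin 3) K)

theorem det_of_last_column {P : Matrix (Fin 4) (Fin 4) K}
    (h : ∀ k : Fin 3, P k.castSucc (Fin.last 3) = 0) :
    P.det = P (Fin.last 3) (Fin.last 3) * (P.submatrix Fin.castSucc Fin.castSucc).det := by
  rw [Matrix.det_succ_column P (Fin.last 3), Fin.sum_univ_castSucc]
  simp [-Fin.reduceLast, h, Fin.succAbove_last, Even.neg_pow (show Even 6 by decide)]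

/-- The rotation with first two rows `v` and `w`. -/
def rotationMatrix (v w : Fin 3 → K) : Matrix (Fin 3) (Fin 3) K := Matrix.of ![v, w, v ⨯₃ w]

theorem rotationMatrix_mul_transpose {v w : Fin 3 → K} (hv : v ⬝ᵥ v = 1) (hw : w ⬝ᵥ w = 1)
    (hvw : v ⬝ᵥ w = 0) : rotationMatrix v w * (rotationMatrix v w)ᵀ = 1 := by
  have hwv : w ⬝ᵥ v = 0 := dotProduct_comm w v ▸ hvw
  have h : (v ⨯₃ w) ⬝ᵥ (v ⨯₃ w) = 1 := by simp [cross_dot_cross, hv, hw, hvw]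
  ext i j
  change (![v, w, v ⨯₃ w] i) ⬝ᵥ (![v, w, v ⨯₃ w] j) = _
  fin_cases i <;> fin_cases j <;>
    simp [hv, hw, hvw, hwv, h, dot_self_cross, dot_cross_self, dotProduct_comm (v ⨯₃ w)]

theorem det_rotationMatrix {v w : Fin 3 → K} (hv : v ⬝ᵥ v = 1) (hw : w ⬝ᵥ w = 1)
    (hvw : v ⬝ᵥ w = 0) : (rotationMatrix v w).det = 1 := by
  have h := triple_product_eq_det v w (v ⨯₃ w)
  rw [cross_cross_eq_smul_sub_smul'] at h
  simp only [dotProduct_sub, dotProduct_smul, hv, hw, hvw] at h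
  exact h.symm.trans (by simp)

/-- The normalizing matrix with similitude block `t • rotationMatrix v w` and last row `(b, t ^ 2)`. -/
def normalizingMatrix (b : Fin 3 → K) (t : K) (v w : Fin 3 → K) : Matrix (Fin 4) (Fin 4) K :=
  Matrix.of (Fin.snoc (fun k : Fin 3 => Fin.snoc (t • rotationMatrix v w k) 0) (Fin.snoc b (t ^ 2)))

section

variable (b : Fin 3 → K) (t : K) (v w : Fin 3 → K)

@[simp]
theorem normalizingMatrix_castSucc_last (k : Fin 3) :
    normalizingMatrix b t v w k.castSucc (Fin.last 3) = 0 := by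
  simp [-Fin.reduceLast, normalizingMatrix]

@[simp]
theorem normalizingMatrix_last_last :
    normalizingMatrix b t v w (Fin.last 3) (Fin.last 3) = t ^ 2 := by
  simp [-Fin.reduceLast, normalizingMatrix]

@[simp]
theorem normalizingMatrix_last_castSucc (k : Fin 3) :
    normalizingMatrix b t v w (Fin.last 3) k.castSucc = b k := by
  simp [-Fin.reduceLast, normalizingMatrix]

@[simp]
theorem normalizingMatrix_submatrix :
    (normalizingMatrix b t v w).submatrix Fin.castSucc Fin.castSucc = t • rotationMatrix v w := by
  ext i j
  simp [-Fin.reduceLast, normalizingMatrix]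

end

theorem isNormalizing_normalizingMatrix (b : Fin 3 → K) (t : K) {v w : Fin 3 → K}
    (hv : v ⬝ᵥ v = 1) (hw : w ⬝ᵥ w = 1) (hvw : v ⬝ᵥ w = 0) :
    IsNormalizing (normalizingMatrix b t v w) := by
  refine ⟨normalizingMatrix_castSucc_last b t v w, ?_⟩
  rw [normalizingMatrix_submatrix, normalizingMatrix_last_last, transpose_smul, smul_mul_smul_comm,
    mul_eq_one_comm.mp (rotationMatrix_mul_transpose hv hw hvw), sq]

theorem det_normalizingMatrix (b : Fin 3 → K) (t : K) {v w : Fin 3 → K}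
    (hv : v ⬝ᵥ v = 1) (hw : w ⬝ᵥ w = 1) (hvw : v ⬝ᵥ w = 0) :
    (normalizingMatrix b t v w).det = t ^ 5 := by
  rw [det_of_last_column (normalizingMatrix_castSucc_last b t v w), normalizingMatrix_submatrix,
    normalizingMatrix_last_last, det_smul, det_rotationMatrix hv hw hvw, Fintype.card_fin]
  ring

theorem normalizingMatrix_injective {b b' : Fin 3 → K} {t t' : K} {v w v' w' : Fin 3 → K}
    (ht : t ≠ 0) (hv : v ⬝ᵥ v = 1) (hw : w ⬝ᵥ w = 1) (hvw : v ⬝ᵥ w = 0)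
    (hv' : v' ⬝ᵥ v' = 1) (hw' : w' ⬝ᵥ w' = 1) (hvw' : v' ⬝ᵥ w' = 0)
    (h : normalizingMatrix b t v w = normalizingMatrix b' t' v' w') :
    b = b' ∧ t = t' ∧ v = v' ∧ w = w' := by
  have hb : b = b' := by
    ext k
    simpa [-Fin.reduceLast] using congrFun (congrFun h (Fin.last 3)) k.castSucc
  have hsq : t ^ 2 = t' ^ 2 := by
    simpa [-Fin.reduceLast] using congrFun (congrFun h (Fin.last 3)) (Fin.last 3)
  have hA : t • rotationMatrix v w = t' • rotationMatrix v' w' := by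
    simpa [-Fin.reduceLast] using congrArg
      (fun P => P.submatrix (Fin.castSucc (n := 3)) (Fin.castSucc (n := 3))) h
  have hcube : t ^ 3 = t' ^ 3 := by
    simpa [det_smul, det_rotationMatrix hv hw hvw, det_rotationMatrix hv' hw' hvw'] using
      congrArg det hA
  have htt : t = t' := by
    apply mul_left_cancel₀ (pow_ne_zero 2 ht)
    linear_combination hcube - t' * hsq
  subst htt
  have hR := smul_right_injective _ ht hA
  exact ⟨hb, rfl, congrFun hR 0, congrFun hR 1⟩

theorem exists_eq_normalizingMatrix {P : Matrix (Fin 4) (Fin 4) K} (hP : IsNormalizing P)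
    (hdet : P.det ≠ 0) : ∃ (b : Fin 3 → K) (t : K) (v w : Fin 3 → K), t ≠ 0 ∧ v ⬝ᵥ v = 1 ∧
      w ⬝ᵥ w = 1 ∧ v ⬝ᵥ w = 0 ∧ P = normalizingMatrix b t v w := by
  obtain ⟨hcol, hgram⟩ := hP
  rw [det_of_last_column hcol] at hdet
  set A := P.submatrix Fin.castSucc Fin.castSucc
  set μ := P (Fin.last 3) (Fin.last 3) with hμdef
  have hμ : μ ≠ 0 := left_ne_zero_of_mul hdet
  have hAdet : A.det ≠ 0 := right_ne_zero_of_mul hdet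
  have hdetsq : A.det ^ 2 = μ ^ 3 := by
    have := congrArg det hgram
    rwa [det_mul, det_transpose, det_smul, det_one, mul_one, Fintype.card_fin, ← sq] at this
  have hgram' : A * Aᵀ = μ • (1 : Matrix (Fin 3) (Fin 3) K) := by
    have : (μ⁻¹ • Aᵀ) * A = 1 := by rw [smul_mul, hgram, inv_smul_smul₀ hμ]
    rw [mul_eq_one_comm, Matrix.mul_smul, inv_smul_eq_iff₀ hμ] at this
    exact this
  have hadj : A.adjugate = (A.det / μ) • Aᵀ := by
    have : Aᵀ * A * A.adjugate = A.det • Aᵀ := by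
      rw [Matrix.mul_assoc, mul_adjugate, Matrix.mul_smul, Matrix.mul_one]
    rw [hgram, smul_mul, Matrix.one_mul] at this
    rw [div_eq_inv_mul, mul_smul, ← this, inv_smul_smul₀ hμ]
  set t := A.det / μ with ht
  have ht0 : t ≠ 0 := div_ne_zero hAdet hμ
  have htsq : t ^ 2 = μ := by
    rw [ht, div_pow, hdetsq]
    field_simp
  have hrow (i j : Fin 3) : A i ⬝ᵥ A j = if i = j then t ^ 2 else 0 := by
    have := congrFun (congrFun hgram' i) j
    rw [htsq]
    simpa [Matrix.smul_apply, Matrix.one_apply] using (show A i ⬝ᵥ A j = _ from this)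
  have hcross : A 0 ⨯₃ A 1 = t • A 2 := by
    rw [cross_apply]
    ext j
    have := congrFun (congrFun hadj j) 2
    rw [adjugate_fin_three] at this
    fin_cases j <;> simp at this ⊢ <;> linear_combination this
  refine ⟨fun k => P (Fin.last 3) k.castSucc, t, t⁻¹ • A 0, t⁻¹ • A 1, ht0, ?_, ?_, ?_, ?_⟩
  · simp [hrow]
    field_simp
  · simp [hrow]
    field_simp
  · simp [hrow]
  · have hblock : A = t • rotationMatrix (t⁻¹ • A 0) (t⁻¹ • A 1) := by
      ext i j
      fin_cases i
      · simp [rotationMatrix, ht0]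
      · simp [rotationMatrix, ht0]
      · simp [rotationMatrix, hcross, ht0]
    ext i j
    refine Fin.lastCases ?_ (fun i => ?_) i <;> refine Fin.lastCases ?_ (fun j => ?_) j
    · simp [-Fin.reduceLast, htsq, hμdef]
    · simp [-Fin.reduceLast]
    · simp [-Fin.reduceLast, hcol]
    · exact (congrFun (congrFun hblock i) j).trans
        (congrFun (congrFun (normalizingMatrix_submatrix _ t _ _) i) j).symm

theorem card_isNormalizing {p : ℕ} [Fact p.Prime] (hp : p ≠ 2) :
    Nat.card {P : GL (Fin 4) (ZMod p) // IsNormalizing (P : Matrix (Fin 4) (Fin 4) (ZMod p))} =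
      p ^ 3 * ((p - 1) * (p * (p ^ 2 - 1))) := by
  let f : (Fin 3 → ZMod p) × (ZMod p)ˣ × OrthonormalPair (ZMod p) →
      {P : GL (Fin 4) (ZMod p) // IsNormalizing (P : Matrix (Fin 4) (Fin 4) (ZMod p))} := fun x =>
    ⟨GeneralLinearGroup.mkOfDetNeZero (normalizingMatrix x.1 x.2.1 x.2.2.1.1 x.2.2.1.2) (by
        obtain ⟨hv, hw, hvw⟩ := x.2.2.2
        rw [det_normalizingMatrix _ _ hv hw hvw]
        exact pow_ne_zero 5 x.2.1.ne_zero),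
      isNormalizing_normalizingMatrix _ _ x.2.2.2.1 x.2.2.2.2.1 x.2.2.2.2.2⟩
  have hf : Function.Bijective f := by
    constructor
    · rintro ⟨b, t, ⟨v, w⟩, hv, hw, hvw⟩ ⟨b', t', ⟨v', w'⟩, hv', hw', hvw'⟩ h
      have h' : normalizingMatrix b t v w = normalizingMatrix b' t' v' w' :=
        congrArg (fun P => (P.1 : Matrix (Fin 4) (Fin 4) (ZMod p))) h
      obtain ⟨rfl, ht, rfl, rfl⟩ :=
        normalizingMatrix_injective t.ne_zero hv hw hvw hv' hw' hvw' h'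
      obtain rfl := Units.ext ht
      rfl
    · rintro ⟨P, hP⟩
      obtain ⟨b, t, v, w, ht, hv, hw, hvw, h⟩ :=
        exists_eq_normalizingMatrix hP ((isUnit_iff_isUnit_det _).mp P.isUnit).ne_zero
      refine ⟨⟨b, Units.mk0 t ht, ⟨v, w⟩, hv, hw, hvw⟩, Subtype.ext (Units.ext ?_)⟩
      exact h.symm
  rw [← Nat.card_congr (Equiv.ofBijective f hf), Nat.card_prod, Nat.card_prod,
    card_orthonormalPair hp, Nat.card_eq_fintype_card (α := (ZMod p)ˣ), ZMod.card_units]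
  simp [Nat.card_eq_fintype_card, ZMod.card]

end Parametrization

section Action

variable {p : ℕ}

/-- The element of `T` with parameters `r`. -/
def shear (r : Fin 4 → ZMod p) : Matrix (Fin 5) (Fin 5) (ZMod p) :=
  !![1, 0, 0, 0, r 0; 0, 1, 0, 0, r 1; 0, 0, 1, 0, r 2; r 0, r 1, r 2, 1, r 3; 0, 0, 0, 0, 1]

theorem range_shear : Set.range (shear (p := p)) = { M | ∃ r₁ r₂ r₃ r₄ : ZMod p,
    M = !![1, 0, 0, 0, r₁; 0, 1, 0, 0, r₂; 0, 0, 1, 0, r₃; r₁, r₂, r₃, 1, r₄; 0, 0, 0, 0, 1] } := by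
  ext M
  constructor
  · rintro ⟨r, rfl⟩
    exact ⟨r 0, r 1, r 2, r 3, rfl⟩
  · rintro ⟨r₁, r₂, r₃, r₄, rfl⟩
    exact ⟨![r₁, r₂, r₃, r₄], rfl⟩

theorem QofP_four (P : Matrix (Fin 4) (Fin 4) (ZMod p)) :
    QofP p 4 P = !![P 0 0, P 0 1, P 0 2, P 0 3, 0; P 1 0, P 1 1, P 1 2, P 1 3, 0;
      P 2 0, P 2 1, P 2 2, P 2 3, 0; P 3 0, P 3 1, P 3 2, P 3 3, 0; 0, 0, 0, 0, 1] := by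
  ext i j
  fin_cases i <;> fin_cases j <;> rfl

/-- The embedding `P ↦ Q_P` as a monoid homomorphism. -/
def QofPHom (p n : ℕ) :
    Matrix (Fin n) (Fin n) (ZMod p) →* Matrix (Fin (n + 1)) (Fin (n + 1)) (ZMod p) where
  toFun := QofP p n
  map_one' := by simp [QofP, fromBlocks_one]
  map_mul' P P' := by
    simp only [QofP, reindex_apply]
    rw [submatrix_mul_equiv, fromBlocks_multiply]
    simp

theorem QofP_mul_shear_iff {P : Matrix (Fin 4) (Fin 4) (ZMod p)} {r r' : Fin 4 → ZMod p} :
    QofP p 4 P * shear r = shear r' * QofP p 4 P ↔ r' = P *ᵥ r ∧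
      (∀ k j : Fin 3, P k.castSucc (Fin.last 3) * r j.castSucc = 0) ∧
      (∀ j : Fin 3, P (Fin.last 3) (Fin.last 3) * r j.castSucc =
        ∑ k : Fin 3, r' k.castSucc * P k.castSucc j.castSucc) ∧
      ∑ k : Fin 3, r' k.castSucc * P k.castSucc (Fin.last 3) = 0 := by
  rw [QofP_four, shear, shear, ← Matrix.ext_iff, funext_iff]
  simp [Fin.forall_fin_succ, Matrix.mul_apply, Fin.sum_univ_succ, Matrix.mulVec, dotProduct]
  constructor
  · rintro ⟨⟨a₀, a₁, a₂, a⟩, ⟨b₀, b₁, b₂, b⟩, ⟨c₀, c₁, c₂, c⟩, d₀, d₁, d₂, d₃, d⟩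
    exact ⟨⟨a.symm, b.symm, c.symm, d.symm⟩, ⟨⟨a₀, a₁, a₂⟩, ⟨b₀, b₁, b₂⟩, c₀, c₁, c₂⟩,
      ⟨by linear_combination d₀, by linear_combination d₁, by linear_combination d₂⟩,
      by linear_combination -d₃⟩
  · rintro ⟨⟨a, b, c, d⟩, ⟨⟨a₀, a₁, a₂⟩, ⟨b₀, b₁, b₂⟩, c₀, c₁, c₂⟩, ⟨d₀, d₁, d₂⟩, d₃⟩
    exact ⟨⟨a₀, a₁, a₂, a.symm⟩, ⟨b₀, b₁, b₂, b.symm⟩, ⟨c₀, c₁, c₂, c.symm⟩,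
      by linear_combination d₀, by linear_combination d₁, by linear_combination d₂,
      by linear_combination -d₃, d.symm⟩

theorem forall_QofP_mul_shear_iff [Fact p.Prime] {P : Matrix (Fin 4) (Fin 4) (ZMod p)} :
    (∀ r, ∃ r', QofP p 4 P * shear r = shear r' * QofP p 4 P) ↔ IsNormalizing P := by
  refine (forall_congr' fun r =>
    (exists_congr fun r' => QofP_mul_shear_iff).trans exists_eq_left).trans ?_
  have hsum (hcol : ∀ k : Fin 3, P k.castSucc (Fin.last 3) = 0)
      (r : Fin 4 → ZMod p) (j : Fin 3) :
      ∑ k : Fin 3, (P *ᵥ r) k.castSucc * P k.castSucc j.castSucc =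
        ((P.submatrix Fin.castSucc Fin.castSucc)ᵀ *ᵥ (P.submatrix Fin.castSucc Fin.castSucc *ᵥ
          fun i => r i.castSucc)) j := by
    simp [-Fin.reduceLast, Matrix.mulVec, dotProduct, Fin.sum_univ_castSucc (n := 3), hcol, mul_comm]
  constructor
  · intro h
    have hcol (k : Fin 3) : P k.castSucc (Fin.last 3) = 0 := by
      simpa using (h (fun _ => 1)).1 k 0
    refine ⟨hcol, Matrix.ext_of_mulVec_single fun i => ?_⟩
    ext j
    have := (h (Fin.snoc (Pi.single i 1) 0)).2.1 j
    rw [hsum hcol, mulVec_mulVec] at this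
    rw [smul_mulVec, one_mulVec]
    simpa [-Fin.reduceLast] using this.symm
  · rintro ⟨hcol, hgram⟩ r
    refine ⟨fun k j => by rw [hcol, zero_mul], fun j => ?_, ?_⟩
    · rw [hsum hcol, mulVec_mulVec, hgram, smul_mulVec, one_mulVec]
      rfl
    · simp_rw [hcol, mul_zero, Finset.sum_const_zero]

/-- `GL_n` acts on matrices of size `n + 1` by conjugation with `Q_P`. -/
def conjHom (p n : ℕ) :
    GL (Fin n) (ZMod p) →* ConjAct (Matrix (Fin (n + 1)) (Fin (n + 1)) (ZMod p))ˣ :=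
  ConjAct.toConjAct.toMonoidHom.comp (Units.map (QofPHom p n))

open scoped Pointwise in
theorem card_conjugates_mul {n : ℕ} [Fact p.Prime]
    (S : Set (Matrix (Fin (n + 1)) (Fin (n + 1)) (ZMod p))) :
    Nat.card (Set.range fun P : GL (Fin n) (ZMod p) =>
        (fun M => QofP p n (P : Matrix (Fin n) (Fin n) (ZMod p)) * M *
            (QofP p n (P : Matrix (Fin n) (Fin n) (ZMod p)))⁻¹) '' S) *
      Nat.card {P : GL (Fin n) (ZMod p) // ∀ M ∈ S, ∃ M' ∈ S,
        QofP p n (P : Matrix (Fin n) (Fin n) (ZMod p)) * M =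
          M' * QofP p n (P : Matrix (Fin n) (Fin n) (ZMod p))} =
      Nat.card (GL (Fin n) (ZMod p)) := by
  let := MulAction.compHom (Set (Matrix (Fin (n + 1)) (Fin (n + 1)) (ZMod p))) (conjHom p n)
  have hsmul (P : GL (Fin n) (ZMod p)) : P • S =
      (fun M => QofP p n (P : Matrix (Fin n) (Fin n) (ZMod p)) * M *
        (QofP p n (P : Matrix (Fin n) (Fin n) (ZMod p)))⁻¹) '' S := by
    rw [show QofP p n (P : Matrix (Fin n) (Fin n) (ZMod p)) =
      (Units.map (QofPHom p n) P : Matrix (Fin (n + 1)) (Fin (n + 1)) (ZMod p)) from rfl,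
      ← coe_units_inv]
    rfl
  have horbit : (Set.range fun P : GL (Fin n) (ZMod p) =>
      (fun M => QofP p n (P : Matrix (Fin n) (Fin n) (ZMod p)) * M *
        (QofP p n (P : Matrix (Fin n) (Fin n) (ZMod p)))⁻¹) '' S) =
      MulAction.orbit (GL (Fin n) (ZMod p)) S := by
    simp_rw [← hsmul]
    rfl
  have hstab (P : GL (Fin n) (ZMod p)) : (∀ M ∈ S, ∃ M' ∈ S,
      QofP p n (P : Matrix (Fin n) (Fin n) (ZMod p)) * M =
        M' * QofP p n (P : Matrix (Fin n) (Fin n) (ZMod p))) ↔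
      P ∈ MulAction.stabilizer (GL (Fin n) (ZMod p)) S := by
    have hdet : IsUnit (QofP p n (P : Matrix (Fin n) (Fin n) (ZMod p))).det :=
      (isUnit_iff_isUnit_det _).mp (Units.map (QofPHom p n) P).isUnit
    have hsub : (∀ M ∈ S, ∃ M' ∈ S, QofP p n (P : Matrix (Fin n) (Fin n) (ZMod p)) * M =
        M' * QofP p n (P : Matrix (Fin n) (Fin n) (ZMod p))) ↔ P • S ⊆ S := by
      rw [hsmul, Set.image_subset_iff]
      refine forall₂_congr fun M _ => ⟨?_, fun h => ⟨_, h, ?_⟩⟩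
      · rintro ⟨M', hM', h⟩
        rwa [Set.mem_preimage, h, mul_nonsing_inv_cancel_right _ _ hdet]
      · rw [nonsing_inv_mul_cancel_right _ _ hdet]
    rw [hsub, MulAction.mem_stabilizer_iff]
    refine ⟨fun h => Set.eq_of_subset_of_ncard_le h ?_ S.toFinite, fun h => h.subset⟩
    exact (Set.ncard_image_of_injective S (MulAction.injective (conjHom p n P))).ge
  rw [horbit, Nat.card_congr (Equiv.subtypeEquivRight hstab)]
  have := Nat.card_congr (MulAction.orbitProdStabilizerEquivGroup (GL (Fin n) (ZMod p)) S)
  rwa [Nat.card_prod] at this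

end Action

/-- `n = 4, k = 3, s = 1`: the number of distinct sets
`Q_P·T·Q_P⁻¹` for `P ∈ GL_4(Fp)` is `p²(p⁴-1)(p³-1)`. -/
theorem stmt_18 (p : ℕ) (hp : p.Prime) (hodd : Odd p) :
    Nat.card (Set.range fun P : GL (Fin 4) (ZMod p) =>
        (fun M => QofP p 4 (P : Matrix (Fin 4) (Fin 4) (ZMod p)) * M *
            (QofP p 4 (P : Matrix (Fin 4) (Fin 4) (ZMod p)))⁻¹) ''
          { M | ∃ r₁ r₂ r₃ r₄ : ZMod p,
              M = !![1, 0, 0, 0, r₁; 0, 1, 0, 0, r₂; 0, 0, 1, 0, r₃;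
                     r₁, r₂, r₃, 1, r₄; 0, 0, 0, 0, 1] }) =
      p ^ 2 * (p ^ 4 - 1) * (p ^ 3 - 1) := by
  have : Fact p.Prime := ⟨hp⟩
  have hp2 : p ≠ 2 := by
    rintro rfl
    exact absurd hodd (by decide)
  rw [← range_shear]
  have h := card_conjugates_mul (Set.range (shear (p := p)))
  simp only [Set.forall_mem_range, Set.exists_range_iff, forall_QofP_mul_shear_iff] at h
  rw [card_isNormalizing hp2, card_GL_field, Fin.prod_univ_four, ZMod.card] at h
  have hpos : 0 < p ^ 3 * ((p - 1) * (p * (p ^ 2 - 1))) := by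
    have h1 : 0 < p - 1 := Nat.sub_pos_of_lt hp.one_lt
    have h2 : 0 < p ^ 2 - 1 := Nat.sub_pos_of_lt (Nat.one_lt_pow two_ne_zero hp.one_lt)
    have := hp.pos
    positivity
  refine Nat.eq_of_mul_eq_mul_right hpos (h.trans ?_)
  have e1 : p ^ 4 - p ^ 1 = p * (p ^ 3 - 1) := by rw [Nat.mul_sub]; ring_nf
  have e2 : p ^ 4 - p ^ 2 = p ^ 2 * (p ^ 2 - 1) := by rw [Nat.mul_sub]; ring_nf
  have e3 : p ^ 4 - p ^ 3 = p ^ 3 * (p - 1) := by rw [Nat.mul_sub]; ring_nf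
  change (p ^ 4 - p ^ 0) * (p ^ 4 - p ^ 1) * (p ^ 4 - p ^ 2) * (p ^ 4 - p ^ 3) = _
  rw [e1, e2, e3, pow_zero]
  ring
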